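/- arXiv:2312.12971 — 7 statements merged into one kernel-verified Lean document; each statement's English description precedes it below -/
import Mathlib

section
/- Let p be a prime and n ≥ 1. In the group of permutations of (Fin p)^n, the following two identities hold: τ_n^{-1} ∘ σ_n ∘ τ_n = (σ_1 ⊔ id) ∘ (σ_{n-1} × id_p), and τ_n ∘ σ_n ∘ τ_n^{-1} = (σ_{n-1} ⊔ id) ∘ (σ_1 × id_{p^{n-1}}), where in each composite the factor written on the right is applied first. Here σ_{n-1} × id_p sends (i_1,…,i_n) to (σ_{n-1}(i_1,…,i_{n-1}), i_n); σ_1 ⊔ id fixes every tuple whose first n−1 digits are not all 0 and adds 1 mod p to the last digit of tuples of the form (0,…,0,i_n); σ_1 × id_{p^{n-1}} sends (i_1,…,i_n) to (i_1 + 1 mod p, i_2,…,i_n); and σ_{n-1} ⊔ id fixes every tuple with i_1 ≠ 0 and applies σ_{n-1} to (i_2,…,i_n) when i_1 = 0. -/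
/-- Identification of digit tuples `(Fin p)^m` (first digit most significant) with `Fin (p^m)`
via base-`p` digits. -/
def msbEquiv (p m : ℕ) : (Fin m → Fin p) ≃ Fin (p ^ m) :=
  (Equiv.piCongrLeft' (fun _ => Fin p) Fin.revPerm).trans finFunctionFinEquiv

/-- The digit rotation `τ_m : (i_1, …, i_m) ↦ (i_m, i_1, …, i_{m-1})` of digit tuples. -/
def rotPerm (p m : ℕ) [NeZero m] : Equiv.Perm (Fin m → Fin p) :=
  Equiv.piCongrLeft' (fun _ => Fin p) (Equiv.addRight (1 : Fin m))

/-- The permutation `σ_m` of digit tuples corresponding to `x ↦ x + 1 mod p^m` on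
`Fin (p^m)`. -/
def sigmaDigits (p m : ℕ) [NeZero (p ^ m)] : Equiv.Perm (Fin m → Fin p) :=
  Equiv.permCongr (msbEquiv p m).symm (Equiv.addRight (1 : Fin (p ^ m)))

variable (p n : ℕ) [NeZero p]

/-- `σ_n × id_p` : applies `σ_n` to the first `n` digits, leaving the last digit fixed. -/
def sigTimesId (f : Fin (n + 1) → Fin p) : Fin (n + 1) → Fin p :=
  fun j => Fin.lastCases (f (Fin.last n))
    (fun k => sigmaDigits p n (fun i => f i.castSucc) k) j

/-- `σ_1 ⊔ id` : fixes every tuple whose first `n` digits are not all `0`, and adds `1`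
(mod `p`) to the last digit of tuples of the form `(0, …, 0, i_{n+1})`. -/
def sigOnePlusId (f : Fin (n + 1) → Fin p) : Fin (n + 1) → Fin p :=
  if ∀ k : Fin n, f k.castSucc = 0 then
    Function.update f (Fin.last n) (f (Fin.last n) + 1)
  else f

/-- `σ_1 × id_{p^n}` : adds `1` (mod `p`) to the first digit. -/
def sigOneTimesId (f : Fin (n + 1) → Fin p) : Fin (n + 1) → Fin p :=
  Function.update f 0 (f 0 + 1)

/-- `σ_n ⊔ id` : fixes every tuple with first digit `≠ 0`, and applies `σ_n` to the last
`n` digits when the first digit is `0`. -/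
def sigPlusId (f : Fin (n + 1) → Fin p) : Fin (n + 1) → Fin p :=
  if f 0 = 0 then
    fun j => Fin.cases (f 0) (fun k => sigmaDigits p n (fun i => f i.succ) k) j
  else f

set_option linter.unusedSectionVars false

theorem msbEquiv_val (m : ℕ) (f : Fin m → Fin p) :
    (msbEquiv p m f : ℕ) = ∑ i : Fin m, (f i.rev : ℕ) * p ^ (i : ℕ) :=
  finFunctionFinEquiv_apply _

theorem msbEquiv_cons (a : Fin p) (g : Fin n → Fin p) :
    (msbEquiv p (n + 1) (Fin.cons a g) : ℕ) = a * p ^ n + msbEquiv p n g := by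
  simp [msbEquiv_val, Fin.sum_univ_castSucc, Fin.rev_castSucc, add_comm]

theorem msbEquiv_snoc (g : Fin n → Fin p) (a : Fin p) :
    (msbEquiv p (n + 1) (Fin.snoc (α := fun _ => Fin p) g a) : ℕ)
      = msbEquiv p n g * p + a := by
  simp [msbEquiv_val, Fin.sum_univ_succ, Fin.rev_succ, Finset.sum_mul, pow_succ, mul_assoc,
    add_comm]

theorem msbEquiv_sigmaDigits (m : ℕ) (f : Fin m → Fin p) :
    (msbEquiv p m (sigmaDigits p m f) : ℕ) = (msbEquiv p m f + 1) % p ^ m := by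
  simp [sigmaDigits, Equiv.permCongr_apply, Fin.val_add]

theorem msbEquiv_zero (m : ℕ) : (msbEquiv p m 0 : ℕ) = 0 := by
  simp [msbEquiv_val]

variable {p n} in
theorem eq_of_msbEquiv_val_eq {f g : Fin n → Fin p}
    (h : (msbEquiv p n f : ℕ) = msbEquiv p n g) : f = g :=
  (msbEquiv p n).injective (Fin.ext h)

theorem Fin.val_add_one_eq_add_one_mod (a : Fin p) : ((a + 1 : Fin p) : ℕ) = (a + 1) % p := by
  simp [Fin.val_add]

/-- Incrementing carries into the first digit exactly when the other digits become zero. -/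
theorem sigmaDigits_cons (a : Fin p) (g : Fin n → Fin p) :
    sigmaDigits p (n + 1) (Fin.cons a g)
      = Fin.cons (if sigmaDigits p n g = 0 then a + 1 else a) (sigmaDigits p n g) := by
  apply eq_of_msbEquiv_val_eq
  have hg := (msbEquiv p n g).isLt
  have hs := msbEquiv_sigmaDigits p n g
  rw [msbEquiv_sigmaDigits, msbEquiv_cons, msbEquiv_cons]
  rcases Nat.lt_or_ge (msbEquiv p n g + 1) (p ^ n) with h | h
  · rw [Nat.mod_eq_of_lt h] at hs
    have h0 : sigmaDigits p n g ≠ 0 := by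
      intro h0
      rw [h0, msbEquiv_zero] at hs
      omega
    rw [if_neg h0, hs, Nat.mod_eq_of_lt, add_assoc]
    have := Nat.mul_le_mul_right (p ^ n) (Nat.succ_le_of_lt a.isLt)
    rw [Nat.succ_mul] at this
    rw [pow_succ']
    omega
  · have h' : (msbEquiv p n g : ℕ) + 1 = p ^ n := by omega
    rw [h', Nat.mod_self] at hs
    have h0 : sigmaDigits p n g = 0 :=
      eq_of_msbEquiv_val_eq (hs.trans (msbEquiv_zero p n).symm)
    rw [if_pos h0, hs, add_assoc, h', Fin.val_add_one_eq_add_one_mod, pow_succ', ← Nat.succ_mul,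
      Nat.mul_mod_mul_right, add_zero]

/-- Incrementing adds one to the last digit, and carries exactly when that digit becomes zero. -/
theorem sigmaDigits_snoc (g : Fin n → Fin p) (a : Fin p) :
    sigmaDigits p (n + 1) (Fin.snoc (α := fun _ => Fin p) g a)
      = Fin.snoc (α := fun _ => Fin p)
          (if a + 1 = 0 then sigmaDigits p n g else g) (a + 1) := by
  apply eq_of_msbEquiv_val_eq
  have hg := (msbEquiv p n g).isLt
  have hs := Fin.val_add_one_eq_add_one_mod p a
  rw [msbEquiv_sigmaDigits, msbEquiv_snoc, msbEquiv_snoc]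
  rcases Nat.lt_or_ge ((a : ℕ) + 1) p with h | h
  · rw [Nat.mod_eq_of_lt h] at hs
    have h0 : a + 1 ≠ 0 := by
      intro h0
      rw [h0, Fin.val_zero] at hs
      omega
    rw [if_neg h0, hs, Nat.mod_eq_of_lt, add_assoc]
    have := Nat.mul_le_mul_right p (Nat.succ_le_of_lt hg)
    rw [Nat.succ_mul] at this
    rw [pow_succ]
    omega
  · have h' : (a : ℕ) + 1 = p := by omega
    rw [h', Nat.mod_self] at hs
    have h0 : a + 1 = 0 := Fin.ext (by rw [hs, Fin.val_zero])
    rw [if_pos h0, hs, add_assoc, h', msbEquiv_sigmaDigits, pow_succ, ← Nat.succ_mul,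
      Nat.mul_mod_mul_right, add_zero]

theorem rotPerm_symm_cons (a : Fin p) (g : Fin n → Fin p) :
    (rotPerm p (n + 1)).symm (Fin.cons a g) = Fin.snoc (α := fun _ => Fin p) g a := by
  funext j
  rw [rotPerm, Equiv.piCongrLeft'_symm]
  change (Fin.cons a g : Fin (n + 1) → Fin p) (j + 1) = _
  induction j using Fin.lastCases with
  | last => simp
  | cast k => simp [Fin.coeSucc_eq_succ]

theorem rotPerm_snoc (g : Fin n → Fin p) (a : Fin p) :
    rotPerm p (n + 1) (Fin.snoc (α := fun _ => Fin p) g a) = Fin.cons a g := by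
  rw [← rotPerm_symm_cons, Equiv.apply_symm_apply]

theorem sigTimesId_snoc (g : Fin n → Fin p) (a : Fin p) :
    sigTimesId p n (Fin.snoc (α := fun _ => Fin p) g a)
      = Fin.snoc (α := fun _ => Fin p) (sigmaDigits p n g) a := by
  funext j
  induction j using Fin.lastCases <;> simp [sigTimesId]

theorem sigOnePlusId_snoc (g : Fin n → Fin p) (a : Fin p) :
    sigOnePlusId p n (Fin.snoc (α := fun _ => Fin p) g a)
      = Fin.snoc (α := fun _ => Fin p) g (if g = 0 then a + 1 else a) := by
  by_cases h : g = 0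
  · simp [sigOnePlusId, h, Fin.update_snoc_last]
  · have h' : ¬ ∀ k, g k = 0 := fun h' => h (funext h')
    simp only [sigOnePlusId, Fin.snoc_castSucc, if_neg h, if_neg h']

theorem sigOneTimesId_cons (a : Fin p) (g : Fin n → Fin p) :
    sigOneTimesId p n (Fin.cons a g) = Fin.cons (a + 1) g := by
  simp [sigOneTimesId]

theorem sigPlusId_cons (a : Fin p) (g : Fin n → Fin p) :
    sigPlusId p n (Fin.cons a g)
      = Fin.cons a (if a = 0 then sigmaDigits p n g else g) := by
  by_cases h : a = 0
  · funext j
    induction j using Fin.cases <;> simp [sigPlusId, h]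
  · simp [sigPlusId, h]

/-- let `p` be a prime and `n ≥ 1` (written `n + 1`).  In the group of
permutations of `(Fin p)^{n+1}` one has
`τ_{n+1}⁻¹ ∘ σ_{n+1} ∘ τ_{n+1} = (σ_1 ⊔ id) ∘ (σ_n × id_p)` and
`τ_{n+1} ∘ σ_{n+1} ∘ τ_{n+1}⁻¹ = (σ_n ⊔ id) ∘ (σ_1 × id_{p^n})`, where in each composite
the factor written on the right is applied first. -/
theorem statement0 (hp : p.Prime) :
    (∀ f : Fin (n + 1) → Fin p,
        (rotPerm p (n + 1)).symm (sigmaDigits p (n + 1) (rotPerm p (n + 1) f))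
          = sigOnePlusId p n (sigTimesId p n f))
      ∧ ∀ f : Fin (n + 1) → Fin p,
        rotPerm p (n + 1) (sigmaDigits p (n + 1) ((rotPerm p (n + 1)).symm f))
          = sigPlusId p n (sigOneTimesId p n f) := by
  refine ⟨fun f => ?_, fun f => ?_⟩
  · obtain ⟨g, a, rfl⟩ : ∃ (g : Fin n → Fin p) (a : Fin p),
        f = Fin.snoc (α := fun _ => Fin p) g a :=
      ⟨_, _, (Fin.snoc_init_self f).symm⟩
    rw [rotPerm_snoc, sigmaDigits_cons, rotPerm_symm_cons, sigTimesId_snoc, sigOnePlusId_snoc]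
  · obtain ⟨a, g, rfl⟩ : ∃ (a : Fin p) (g : Fin n → Fin p), f = Fin.cons a g :=
      ⟨_, _, (Fin.cons_self_tail f).symm⟩
    rw [rotPerm_symm_cons, sigmaDigits_snoc, rotPerm_snoc, sigOneTimesId_cons, sigPlusId_cons]
end

section
/- Let p be a prime and k ≥ 0. For every 0 ≤ l ≤ p^k − 1 and every 1 ≤ j ≤ p, the following identity holds in the group of permutations of Fin p × ZMod (p^k): τ_{k+1} ∘ σ_{k+1}^{p·l + j} ∘ τ_{k+1}^{-1} = (σ_1^j × id) ∘ B_{l,j}, where B_{l,j} is applied first, (σ_1^j × id)(i, y) = (i + j mod p, y), and B_{l,j}(i, y) = (i, y + l) if i + j ≤ p − 1 and B_{l,j}(i, y) = (i, y + l + 1) if i + j ≥ p (here i + j is computed in ℕ with 0 ≤ i ≤ p − 1). -/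
/-- The permutation of `Fin (p^m)` corresponding to a permutation of digit tuples. -/
def digitPerm (p m : ℕ) (e : Equiv.Perm (Fin m → Fin p)) : Equiv.Perm (Fin (p ^ m)) :=
  Equiv.permCongr (msbEquiv p m) e

/-- The equivalence `ZMod n ≃ Fin n` for `n ≠ 0`. -/
def zmodFinEquiv (n : ℕ) [NeZero n] : ZMod n ≃ Fin n where
  toFun x := ⟨x.val, ZMod.val_lt x⟩
  invFun i := ((i : ℕ) : ZMod n)
  left_inv x := ZMod.natCast_rightInverse x
  right_inv i := by
    ext
    exact ZMod.val_cast_of_lt i.isLt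

/-- Identification of `Fin (p^{k+1})` with `Fin p × ZMod (p^k)`, reading off the first
(most significant) base-`p` digit and the number formed by the remaining `k` digits. -/
def splitEquiv (p k : ℕ) [NeZero p] : Fin (p ^ (k + 1)) ≃ Fin p × ZMod (p ^ k) :=
  ((finCongr (pow_succ' p k)).trans finProdFinEquiv.symm).trans
    (Equiv.prodCongr (Equiv.refl (Fin p)) (zmodFinEquiv (p ^ k)).symm)

variable (p k : ℕ) [NeZero p]

/-- The permutation `σ_{k+1}` (i.e. `x ↦ x + 1 mod p^{k+1}`), transported to
`Fin p × ZMod (p^k)`. -/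
def sigmaSplit : Equiv.Perm (Fin p × ZMod (p ^ k)) :=
  Equiv.permCongr (splitEquiv p k) (Equiv.addRight (1 : Fin (p ^ (k + 1))))

/-- The digit rotation `τ_{k+1}`, transported to `Fin p × ZMod (p^k)`. -/
def tauSplit : Equiv.Perm (Fin p × ZMod (p ^ k)) :=
  Equiv.permCongr (splitEquiv p k) (digitPerm p (k + 1) (rotPerm p (k + 1)))

/-- Digit rotation sends the number `n` to `n % p` as leading digit followed by `n / p`. -/
theorem val_digitPerm_rotPerm (n : Fin (p ^ (k + 1))) :
    (digitPerm p (k + 1) (rotPerm p (k + 1)) n : ℕ) = (n : ℕ) / p + p ^ k * ((n : ℕ) % p) := by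
  obtain ⟨f, rfl⟩ := (msbEquiv p (k + 1)).surjective n
  have hn : (msbEquiv p (k + 1) f : ℕ)
      = f (Fin.last k) + p * ∑ i : Fin k, (f i.succ.rev : ℕ) * p ^ (i : ℕ) := by
    simp [msbEquiv, Fin.sum_univ_succ, Finset.mul_sum, pow_succ', mul_left_comm]
  have hτ : (digitPerm p (k + 1) (rotPerm p (k + 1)) (msbEquiv p (k + 1) f) : ℕ)
      = ∑ i : Fin k, (f i.succ.rev : ℕ) * p ^ (i : ℕ) + p ^ k * f (Fin.last k) := by
    have hlast : (0 : Fin (k + 1)) - 1 = Fin.last k := by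
      rw [sub_eq_iff_eq_add]; simp
    have hsub (i : Fin k) : i.castSucc.rev - 1 = i.succ.rev := by
      rw [sub_eq_iff_eq_add, Fin.rev_castSucc, Fin.rev_succ, Fin.coeSucc_eq_succ]
    simp only [digitPerm, rotPerm, msbEquiv, Equiv.permCongr_apply, Equiv.symm_apply_apply]
    simp [Fin.sum_univ_castSucc, ← sub_eq_add_neg, hsub, hlast, mul_comm (p ^ k)]
  rw [hτ, hn, Nat.add_mul_div_left _ _ (NeZero.pos p), Nat.add_mul_mod_self_left,
    Nat.mod_eq_of_lt (f _).isLt, Nat.div_eq_of_lt (f _).isLt, zero_add]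

theorem splitEquiv_eq_of_val_eq (n : Fin (p ^ (k + 1))) (a : Fin p) (b : ℕ) (hb : b < p ^ k)
    (h : (n : ℕ) = b + p ^ k * a) : splitEquiv p k n = (a, (b : ZMod (p ^ k))) := by
  have hpos : 0 < p ^ k := NeZero.pos _
  ext1
  · ext
    simp [splitEquiv, h, Nat.add_mul_div_left _ _ hpos, Nat.div_eq_of_lt hb]
  · simp [splitEquiv, zmodFinEquiv, h, Nat.mod_eq_of_lt hb]

theorem tauSplit_splitEquiv_ofNat (n : ℕ) :
    tauSplit p k (splitEquiv p k (Fin.ofNat _ n))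
      = (Fin.ofNat p n, ((n / p : ℕ) : ZMod (p ^ k))) := by
  have hlt : n % p ^ (k + 1) / p < p ^ k := by
    rw [Nat.div_lt_iff_lt_mul (NeZero.pos p), ← pow_succ]
    exact Nat.mod_lt _ (NeZero.pos _)
  simp only [tauSplit, Equiv.permCongr_apply, Equiv.symm_apply_apply]
  rw [splitEquiv_eq_of_val_eq p k _ (Fin.ofNat p n) (n % p ^ (k + 1) / p) hlt]
  · rw [pow_succ', Nat.mod_mul_right_div_self, ZMod.natCast_mod]
  · rw [val_digitPerm_rotPerm]
    simp [Nat.mod_mod_of_dvd n (dvd_pow_self p k.succ_ne_zero)]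

theorem sigmaSplit_pow_splitEquiv_ofNat (m n : ℕ) :
    (sigmaSplit p k ^ m) (splitEquiv p k (Fin.ofNat _ n))
      = splitEquiv p k (Fin.ofNat _ (n + m)) := by
  induction m with
  | zero => simp
  | succ m ih =>
    rw [pow_succ', Equiv.Perm.mul_apply, ih]
    simp only [sigmaSplit, Equiv.permCongr_apply, Equiv.symm_apply_apply, Equiv.coe_addRight]
    congr 1
    ext
    simp [Fin.val_add, ← add_assoc]

theorem addRight_one_pow_apply (j : ℕ) (i : Fin p) :
    (Equiv.addRight (1 : Fin p) ^ j) i = Fin.ofNat p (i + j) := by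
  induction j with
  | zero => ext; simp
  | succ j ih =>
    rw [pow_succ', Equiv.Perm.mul_apply, ih]
    ext
    simp [Fin.val_add, ← add_assoc]

/-- let `p` be a prime and `k ≥ 0`.  For every `0 ≤ l ≤ p^k − 1` and every
`1 ≤ j ≤ p`, the identity `τ_{k+1} ∘ σ_{k+1}^{p·l + j} ∘ τ_{k+1}⁻¹ = (σ_1^j × id) ∘ B_{l,j}`
holds in the group of permutations of `Fin p × ZMod (p^k)`, where `B_{l,j}` is applied
first, `(σ_1^j × id)(i, y) = (i + j mod p, y)`, and `B_{l,j}(i, y) = (i, y + l)` if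
`i + j ≤ p − 1` while `B_{l,j}(i, y) = (i, y + l + 1)` if `i + j ≥ p` (with `i + j`
computed in `ℕ`). -/
theorem statement1 (hp : p.Prime) (l j : ℕ) (hl : l ≤ p ^ k - 1) (hj : 1 ≤ j) (hjp : j ≤ p) :
    ∀ x : Fin p × ZMod (p ^ k),
      tauSplit p k ((sigmaSplit p k ^ (p * l + j)) ((tauSplit p k).symm x))
        = if (x.1 : ℕ) + j ≤ p - 1 then
            ((Equiv.addRight (1 : Fin p) ^ j) x.1, x.2 + (l : ZMod (p ^ k)))
          else
            ((Equiv.addRight (1 : Fin p) ^ j) x.1, x.2 + (l : ZMod (p ^ k)) + 1) := by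
  rintro ⟨i, y⟩
  have hp0 : 0 < p := hp.pos
  have hi := i.isLt
  have hx : (i, y) = tauSplit p k (splitEquiv p k (Fin.ofNat _ (i + p * y.val))) := by
    rw [tauSplit_splitEquiv_ofNat, Nat.add_mul_div_left _ _ hp0, Nat.div_eq_of_lt hi, zero_add,
      ZMod.natCast_zmod_val]
    ext <;> simp [Nat.mod_eq_of_lt]
  have hsum : (i : ℕ) + p * y.val + (p * l + j) = i + j + p * (y.val + l) := by ring
  rw [hx, Equiv.symm_apply_apply, ← hx, sigmaSplit_pow_splitEquiv_ofNat,
    tauSplit_splitEquiv_ofNat, hsum, Nat.add_mul_div_left _ _ hp0, addRight_one_pow_apply]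
  have hfst : Fin.ofNat p (i + j + p * (y.val + l)) = Fin.ofNat p (i + j) := by
    ext; simp
  rw [hfst]
  split_ifs with h
  · rw [Nat.div_eq_of_lt (by simp only at h; omega)]
    simp
  · have hq : ((i : ℕ) + j) / p = 1 := by
      simp only at h
      exact Nat.div_eq_of_lt_le (by omega) (by omega)
    rw [hq]
    simp [add_comm]
end

section
/- Let p be a prime and A an abelian group. For all a, b ∈ A, the element (a + b)^{⊗p} − a^{⊗p} − b^{⊗p} of A^{⊗p} lies in the image of the norm map N_p = Σ_{s=0}^{p−1} σ_1^s : A^{⊗p} → A^{⊗p}. -/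
open scoped TensorProduct

noncomputable section

/-- The `m`-fold tensor power over `ℤ` of an abelian group `A`, indexed by `Fin m`. -/
abbrev Tp (A : Type*) [AddCommGroup A] (m : ℕ) : Type _ := ⨂[ℤ] _ : Fin m, A

/-- The cyclic permutation `σ` on the tensor power, induced by reindexing along
`x ↦ x + 1` on `Fin m`, so that `σ(a_1 ⊗ ⋯ ⊗ a_m) = a_m ⊗ a_1 ⊗ ⋯ ⊗ a_{m-1}`. -/
def sigmaT (A : Type*) [AddCommGroup A] (m : ℕ) [NeZero m] : Tp A m ≃ₗ[ℤ] Tp A m :=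
  PiTensorProduct.reindex ℤ (fun _ : Fin m => A) (Equiv.addRight (1 : Fin m))

/-- The norm (transfer) map `N_m = Σ_{s=0}^{m-1} σ_m^s` on the tensor power. -/
def normT (A : Type*) [AddCommGroup A] (m : ℕ) [NeZero m] : Tp A m → Tp A m :=
  fun x => ∑ s ∈ Finset.range m, (⇑(sigmaT A m))^[s] x

end

/-- The elementary tensor with entry `a` in the positions of `S` and entry `b` elsewhere. -/
def piecewiseTensor {A : Type*} [AddCommGroup A] {m : ℕ} (a b : A) (S : Finset (Fin m)) :
    Tp A m :=
  PiTensorProduct.tprod ℤ (S.piecewise (fun _ => a) (fun _ => b))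

theorem sigmaT_piecewiseTensor {A : Type*} [AddCommGroup A] {m : ℕ} [NeZero m] (a b : A)
    (S : Finset (Fin m)) :
    sigmaT A m (piecewiseTensor a b S) =
      piecewiseTensor a b (S.map (Equiv.addRight (1 : Fin m)).toEmbedding) := by
  unfold sigmaT piecewiseTensor
  refine (PiTensorProduct.reindex_tprod (R := ℤ) (s := fun _ : Fin m => A) _ _).trans ?_
  congr 1
  funext i
  simp only [Finset.piecewise, Finset.mem_map_equiv]

/-- The mean modulo `p` of the elements of a subset of `Fin p`. -/
def meanMod {p : ℕ} [Fact p.Prime] (S : Finset (Fin p)) : ZMod p :=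
  (∑ x ∈ S, ((x : ℕ) : ZMod p)) / (S.card : ZMod p)

theorem meanMod_map_addRight_one {p : ℕ} [NeZero p] [Fact p.Prime] {S : Finset (Fin p)}
    (hS : S.Nonempty) (hS' : S ≠ Finset.univ) :
    meanMod (S.map (Equiv.addRight (1 : Fin p)).toEmbedding) = meanMod S + 1 := by
  have hcard : (S.card : ZMod p) ≠ 0 := by
    rw [Ne, ZMod.natCast_eq_zero_iff]
    intro h
    have hlt := (Finset.card_lt_iff_ne_univ S).2 hS'
    rw [Fintype.card_fin] at hlt
    exact absurd (Nat.le_of_dvd hS.card_pos h) hlt.not_ge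
  have hval (x : Fin p) : (((x + 1 : Fin p) : ℕ) : ZMod p) = ((x : ℕ) : ZMod p) + 1 := by
    simp [Fin.val_add]
  simp only [meanMod, Finset.sum_map, Finset.card_map, Equiv.coe_toEmbedding,
    Equiv.coe_addRight, hval, Finset.sum_add_distrib, Finset.sum_const, nsmul_eq_mul, mul_one]
  field_simp

theorem sum_meanMod_eq_iterate_sigmaT {p : ℕ} [NeZero p] [Fact p.Prime] {A : Type*}
    [AddCommGroup A] (a b : A) (s : ℕ) :
    ∑ S : Finset (Fin p) with (S.Nonempty ∧ S ≠ Finset.univ) ∧ meanMod S = s,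
        piecewiseTensor a b S =
      (sigmaT A p)^[s] (∑ S : Finset (Fin p) with
        (S.Nonempty ∧ S ≠ Finset.univ) ∧ meanMod S = 0, piecewiseTensor a b S) := by
  induction s with
  | zero => simp
  | succ s ih =>
    rw [Function.iterate_succ_apply', ← ih, map_sum]
    symm
    refine Finset.sum_equiv (Equiv.addRight (1 : Fin p)).finsetCongr (fun S => ?_)
      (fun S _ => sigmaT_piecewiseTensor a b S)
    have huniv : S.map (Equiv.addRight (1 : Fin p)).toEmbedding = Finset.univ ↔
        S = Finset.univ := by
      simp only [← Finset.card_eq_iff_eq_univ, Finset.card_map]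
    simp only [Finset.mem_filter, Finset.mem_univ, true_and, Equiv.finsetCongr_apply,
      Finset.map_nonempty, Ne, huniv]
    refine and_congr_right fun h => ?_
    rw [meanMod_map_addRight_one h.1 h.2, Nat.cast_succ, add_left_inj]

/-- for a prime `p` and an abelian group `A`, for all `a b : A`, the element
`(a+b)^{⊗p} − a^{⊗p} − b^{⊗p}` of `A^{⊗p}` lies in the image of the norm map
`N_p = Σ_{s=0}^{p-1} σ_1^s`. -/
theorem statement4 (p : ℕ) [NeZero p] (hp : p.Prime) (A : Type*) [AddCommGroup A]
    (a b : A) :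
    PiTensorProduct.tprod ℤ (fun _ : Fin p => a + b)
        - PiTensorProduct.tprod ℤ (fun _ : Fin p => a)
        - PiTensorProduct.tprod ℤ (fun _ : Fin p => b)
      ∈ Set.range (normT A p) := by
  have : Fact p.Prime := ⟨hp⟩
  refine ⟨∑ S : Finset (Fin p) with (S.Nonempty ∧ S ≠ Finset.univ) ∧ meanMod S = 0,
    piecewiseTensor a b S, ?_⟩
  have hexpand : PiTensorProduct.tprod ℤ (fun _ : Fin p => a + b) =
      ∑ S : Finset (Fin p), piecewiseTensor a b S :=
    (PiTensorProduct.tprod ℤ).map_add_univ (fun _ : Fin p => a) (fun _ => b)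
  have huniv : PiTensorProduct.tprod ℤ (fun _ : Fin p => a) =
      piecewiseTensor a b Finset.univ := by simp [piecewiseTensor]
  have hempty : PiTensorProduct.tprod ℤ (fun _ : Fin p => b) =
      piecewiseTensor a b ∅ := by simp [piecewiseTensor]
  have hproper : ∑ S : Finset (Fin p) with S.Nonempty ∧ S ≠ Finset.univ,
      piecewiseTensor a b S = ∑ S : Finset (Fin p), piecewiseTensor a b S
        - piecewiseTensor a b Finset.univ - piecewiseTensor a b ∅ := by
    have hne : (∅ : Finset (Fin p)) ∈ Finset.univ.erase Finset.univ :=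
      Finset.mem_erase.2 ⟨Finset.univ_nonempty.ne_empty.symm, Finset.mem_univ _⟩
    rw [← Finset.sum_erase_eq_sub (Finset.mem_univ _), ← Finset.sum_erase_eq_sub hne]
    refine Finset.sum_congr ?_ fun _ _ => rfl
    ext S
    simp [Finset.nonempty_iff_ne_empty]
  rw [hexpand, huniv, hempty, ← hproper, normT,
    ← Finset.sum_fiberwise_of_maps_to
      (s := {S : Finset (Fin p) | S.Nonempty ∧ S ≠ Finset.univ})
      (t := Finset.range p) (g := fun S => (meanMod S).val)
      (fun S _ => Finset.mem_range.2 (ZMod.val_lt _)) (piecewiseTensor a b)]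
  refine Finset.sum_congr rfl fun s hs => ?_
  rw [← sum_meanMod_eq_iterate_sigmaT, Finset.filter_filter]
  congr 1
  refine Finset.filter_congr fun S _ => and_congr_right fun _ => ?_
  rw [← (ZMod.val_injective p).eq_iff, ZMod.val_cast_of_lt (Finset.mem_range.1 hs)]
end

section
/- Let p be a prime and X a type, and let A = (X →₀ ℤ) be the free abelian group on X. Let φ : A → A^{⊗p} be the unique additive (ℤ-linear) map sending each basis element x ∈ X (i.e. Finsupp.single x 1) to the elementary tensor x^{⊗p}. Then φ is an external Frobenius on A: σ_1(φ(f)) = φ(f) for all f ∈ A, and for every f ∈ A the element φ(f) − f^{⊗p} lies in the image of the norm map N_p = Σ_{s=0}^{p−1} σ_1^s on A^{⊗p}. -/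
open scoped TensorProduct

/-- The unique `ℤ`-linear map `(X →₀ ℤ) → (X →₀ ℤ)^{⊗p}` sending each basis element
`x` (i.e. `Finsupp.single x 1`) to the elementary tensor `x^{⊗p}`. -/
noncomputable def phiFree (p : ℕ) (X : Type*) : (X →₀ ℤ) →ₗ[ℤ] Tp (X →₀ ℤ) p :=
  Finsupp.lift (Tp (X →₀ ℤ) p) ℤ X
    (fun x => PiTensorProduct.tprod ℤ (fun _ : Fin p => Finsupp.single x (1 : ℤ)))

/-- If a permutation `e` preserves a finite set `S` and raises a `ZMod p`-valued weight by one, then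
the sum over `S` of an equivariant function is the norm of its sum over the weight-zero part. -/
theorem sum_eq_sum_range_iterate {p : ℕ} [NeZero p] {α M : Type*} [AddCommMonoid M]
    (σ : M →+ M) (S : Finset α) (e : Equiv.Perm α) (w : α → ZMod p) (g : α → M)
    (hS : ∀ a, e a ∈ S ↔ a ∈ S) (hw : ∀ a ∈ S, w (e a) = w a + 1) (hg : ∀ a, σ (g a) = g (e a)) :
    ∑ a ∈ S, g a = ∑ k ∈ Finset.range p, (⇑σ)^[k] (∑ a ∈ S with w a = 0, g a) := by
  have key (k : ℕ) : (⇑σ)^[k] (∑ a ∈ S with w a = 0, g a) = ∑ a ∈ S with w a = k, g a := by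
    induction k with
    | zero => simp
    | succ k ih =>
      rw [Function.iterate_succ_apply', ih, map_sum]
      simp only [hg]
      refine Finset.sum_equiv e (fun a => ?_) (fun _ _ => rfl)
      simp only [Finset.mem_filter, hS]
      refine and_congr_right fun ha => ?_
      rw [hw a ha]
      push_cast
      exact (add_left_inj 1).symm
  simp only [key]
  rw [← Finset.sum_fiberwise S w g]
  refine Finset.sum_bij' (fun c _ => c.val) (fun k _ => (k : ZMod p)) ?_ ?_ ?_ ?_ ?_
  · intro c _
    simpa using ZMod.val_lt c
  · simp
  · simp
  · intro k hk
    exact ZMod.val_cast_of_lt (Finset.mem_range.mp hk)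
  · simp

/-- The norm map on the tensor power as an additive homomorphism. -/
noncomputable def normTHom (A : Type*) [AddCommGroup A] (m : ℕ) [NeZero m] : Tp A m →+ Tp A m where
  toFun := normT A m
  map_zero' := by
    simp only [normT]
    exact Finset.sum_eq_zero fun s _ => iterate_map_zero (sigmaT A m) s
  map_add' x y := by
    simp only [normT, ← Finset.sum_add_distrib]
    exact Finset.sum_congr rfl fun s _ => iterate_map_add (sigmaT A m) s x y

theorem sigmaT_tprod_const (A : Type*) [AddCommGroup A] (m : ℕ) [NeZero m] (a : A) :
    sigmaT A m (PiTensorProduct.tprod ℤ fun _ => a) = PiTensorProduct.tprod ℤ fun _ => a := by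
  simp only [sigmaT, PiTensorProduct.reindex_tprod]

theorem sigmaT_tprod_piecewise (A : Type*) [AddCommGroup A] (m : ℕ) [NeZero m] (a b : A)
    (s : Finset (Fin m)) :
    sigmaT A m (PiTensorProduct.tprod ℤ (s.piecewise (fun _ => a) fun _ => b)) =
      PiTensorProduct.tprod ℤ
        (((Equiv.addRight (1 : Fin m)).finsetCongr s).piecewise (fun _ => a) fun _ => b) := by
  rw [sigmaT, PiTensorProduct.reindex_tprod]
  congr 1
  funext i
  simp only [Finset.piecewise, Equiv.finsetCongr_apply, Finset.mem_map_equiv]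

theorem tprod_const_add_sub_mem_range_normTHom (A : Type*) [AddCommGroup A] (p : ℕ) [NeZero p]
    (hp : p.Prime) (a b : A) :
    (PiTensorProduct.tprod ℤ fun _ : Fin p => a + b) -
        ((PiTensorProduct.tprod ℤ fun _ => a) + PiTensorProduct.tprod ℤ fun _ => b) ∈
      (normTHom A p).range := by
  classical
  have := Fact.mk hp
  let e := (Equiv.addRight (1 : Fin p)).finsetCongr
  let g : Finset (Fin p) → Tp A p := fun s =>
    PiTensorProduct.tprod ℤ (s.piecewise (fun _ => a) fun _ => b)
  let S : Finset (Finset (Fin p)) := (Finset.univ.erase Finset.univ).erase ∅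
  let w : Finset (Fin p) → ZMod p := fun s => (∑ i ∈ s, ((i : ℕ) : ZMod p)) / (s.card : ZMod p)
  have hS (s : Finset (Fin p)) : e s ∈ S ↔ s ∈ S := by
    have hcard : (e s).card = s.card := by simp [e]
    have h_univ : e s = Finset.univ ↔ s = Finset.univ := by
      rw [← Finset.card_eq_iff_eq_univ, ← Finset.card_eq_iff_eq_univ, hcard]
    have h_empty : e s = ∅ ↔ s = ∅ := by
      rw [← Finset.card_eq_zero, ← Finset.card_eq_zero, hcard]
    simp [S, h_univ, h_empty]
  have hw (s) (hs : s ∈ S) : w (e s) = w s + 1 := by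
    simp only [S, Finset.mem_erase, Finset.mem_univ, and_true] at hs
    have hc : (s.card : ZMod p) ≠ 0 := by
      rw [Ne, ZMod.natCast_eq_zero_iff]
      refine Nat.not_dvd_of_pos_of_lt (Finset.card_pos.mpr (Finset.nonempty_iff_ne_empty.mpr hs.1)) ?_
      simpa using Finset.card_lt_card (Finset.ssubset_univ_iff.mpr hs.2)
    have hshift (i : Fin p) : (((i + 1 : Fin p) : ℕ) : ZMod p) = (i : ℕ) + 1 := by
      simp [Fin.val_add]
    simp only [w, e, Equiv.finsetCongr_apply, Finset.sum_map, Finset.card_map,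
      Equiv.coe_toEmbedding, Equiv.coe_addRight, hshift, Finset.sum_add_distrib, Finset.sum_const,
      nsmul_eq_mul, mul_one]
    field_simp
  have hsum : (PiTensorProduct.tprod ℤ fun _ : Fin p => a + b) = ∑ s, g s :=
    (PiTensorProduct.tprod ℤ).map_add_univ (fun _ => a) fun _ => b
  have hsplit : ∑ s, g s = (∑ s ∈ S, g s) + g ∅ + g Finset.univ := by
    rw [Finset.sum_erase_add _ _ (by simpa using Finset.univ_nonempty.ne_empty.symm),
      Finset.sum_erase_add _ _ (Finset.mem_univ _)]
  refine ⟨∑ s ∈ S with w s = 0, g s, ?_⟩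
  rw [hsum, hsplit, sum_eq_sum_range_iterate (sigmaT A p : Tp A p →+ Tp A p) S e w g hS hw
    (sigmaT_tprod_piecewise A p a b)]
  simp only [g, Finset.piecewise_empty, Finset.piecewise_univ]
  rw [add_assoc, add_comm (PiTensorProduct.tprod ℤ fun _ : Fin p => b), add_sub_cancel_right]
  rfl

/-- The `p`-th tensor power map, additive modulo norms. -/
noncomputable def tprodConstModNorm (A : Type*) [AddCommGroup A] (p : ℕ) [NeZero p]
    (hp : p.Prime) : A →+ Tp A p ⧸ (normTHom A p).range :=
  AddMonoidHom.mk' (fun a => ((PiTensorProduct.tprod ℤ fun _ : Fin p => a : Tp A p) :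
      Tp A p ⧸ (normTHom A p).range)) fun a b => by
    rw [← QuotientAddGroup.mk_add, ← sub_eq_zero, ← QuotientAddGroup.mk_sub,
      QuotientAddGroup.eq_zero_iff]
    exact tprod_const_add_sub_mem_range_normTHom A p hp a b

theorem phiFree_single_one (p : ℕ) (X : Type*) (x : X) :
    phiFree p X (Finsupp.single x 1) =
      PiTensorProduct.tprod ℤ fun _ : Fin p => Finsupp.single x (1 : ℤ) := by
  simp [phiFree]

/-- let `p` be a prime, `X` a type and `A = (X →₀ ℤ)` the free abelian group
on `X`.  The unique additive map `φ : A → A^{⊗p}` sending each basis element `x` to `x^{⊗p}`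
is an external Frobenius on `A`: `σ_1(φ(f)) = φ(f)` for all `f`, and for every `f ∈ A` the
element `φ(f) − f^{⊗p}` lies in the image of the norm map `N_p = Σ_{s=0}^{p-1} σ_1^s`. -/
theorem statement12 (p : ℕ) [NeZero p] (hp : p.Prime) (X : Type*) :
    (∀ f : X →₀ ℤ, sigmaT (X →₀ ℤ) p (phiFree p X f) = phiFree p X f)
      ∧ ∀ f : X →₀ ℤ,
          phiFree p X f - PiTensorProduct.tprod ℤ (fun _ : Fin p => f)
            ∈ Set.range (normT (X →₀ ℤ) p) := by
  refine ⟨fun f => ?_, fun f => ?_⟩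
  · have h : (sigmaT (X →₀ ℤ) p).toLinearMap ∘ₗ phiFree p X = phiFree p X := by
      ext x : 2
      simp [phiFree_single_one, sigmaT_tprod_const]
    exact LinearMap.congr_fun h f
  · have h : (QuotientAddGroup.mk' (normTHom (X →₀ ℤ) p).range).comp (phiFree p X).toAddMonoidHom =
        tprodConstModNorm (X →₀ ℤ) p hp := by
      ext x : 2
      simp [phiFree_single_one, tprodConstModNorm]
    have hf := DFunLike.congr_fun h f
    rw [← sub_eq_zero] at hf
    exact (QuotientAddGroup.eq_zero_iff _).mp hf
end

section
/- Let p be a prime, X a type, A = (X →₀ ℤ) the free abelian group on X, and j ≥ 0. If t ∈ A^{⊗p^j} satisfies N_{p^j}(t) = 0, where N_{p^j} = Σ_{s=0}^{p^j−1} σ_j^s, then t lies in the additive subgroup of A^{⊗p^j} generated by the elements σ_j(s) − s for s ∈ A^{⊗p^j}. (Equivalently, the transfer map from the C_{p^j}-coinvariants of A^{⊗p^j} to the C_{p^j}-invariants induced by N_{p^j} is injective.) -/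
open scoped TensorProduct

section Permutation

variable {Y M : Type*} [AddCommGroup M]

/-- If an additive subgroup identifies `v y` with `v (e y)` for all `y`, then it identifies `v`
along every cycle of the permutation `e`. -/
theorem sub_mem_of_sameCycle {e : Equiv.Perm Y} {S : AddSubgroup M} {v : Y → M}
    (h : ∀ y, v (e y) - v y ∈ S) {y z : Y} (hyz : e.SameCycle y z) : v z - v y ∈ S := by
  obtain ⟨k, rfl⟩ := hyz
  induction k with
  | zero => simp
  | succ k ih =>
    have hk := h ((e ^ (k : ℤ)) y)
    rw [add_comm, zpow_add, zpow_one, Equiv.Perm.mul_apply]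
    simpa using S.add_mem hk ih
  | pred k ih =>
    have hk := h ((e ^ (-(k : ℤ) - 1)) y)
    rw [← Equiv.Perm.mul_apply, ← zpow_one_add, add_sub_cancel] at hk
    simpa using S.sub_mem ih hk

/-- If a linear map permutes a basis of a free abelian group, then every element killed by
a sum of its first `n ≠ 0` iterates is a combination of elements `σ s - s`. -/
theorem mem_closure_of_sum_iterate_eq_zero (b : Module.Basis Y ℤ M) (e : Equiv.Perm Y)
    (σ : M →ₗ[ℤ] M) (hσ : ∀ y, σ (b y) = b (e y)) {n : ℕ} (hn : n ≠ 0) {t : M}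
    (ht : ∑ s ∈ Finset.range n, σ^[s] t = 0) :
    t ∈ AddSubgroup.closure (Set.range fun s ↦ σ s - s) := by
  set S := AddSubgroup.closure (Set.range fun s ↦ σ s - s)
  let Q := Quotient (Equiv.Perm.SameCycle.setoid e)
  let q : Y → Q := Quotient.mk _
  let Φ : M →ₗ[ℤ] Q →₀ ℤ := b.constr ℤ fun y ↦ Finsupp.single (q y) 1
  let Ψ : (Q →₀ ℤ) →ₗ[ℤ] M := Finsupp.linearCombination ℤ fun c ↦ b c.out
  have hΦσ (x : M) : Φ (σ x) = Φ x := by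
    have : Φ ∘ₗ σ = Φ := b.ext fun y ↦ by
      have hq : q (e y) = q y :=
        Quotient.sound (Equiv.Perm.sameCycle_apply_left.2 (Equiv.Perm.SameCycle.refl e y))
      simp [Φ, hσ, hq]
    exact LinearMap.congr_fun this x
  have hΦiter (s : ℕ) (x : M) : Φ (σ^[s] x) = Φ x := by
    induction s with
    | zero => rfl
    | succ s ih => rw [Function.iterate_succ_apply', hΦσ, ih]
  have hΦt : Φ t = 0 := by
    have h := congrArg Φ ht
    simp only [map_sum, hΦiter, Finset.sum_const, Finset.card_range, map_zero] at h
    exact (smul_eq_zero.1 h).resolve_left hn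
  have hΨΦ (x : M) : x - Ψ (Φ x) ∈ S := by
    induction b.mem_span x using Submodule.span_induction with
    | zero => simp
    | add x y _ _ hx hy => simpa [add_sub_add_comm] using S.add_mem hx hy
    | smul r x _ hx => simpa [smul_sub] using S.zsmul_mem hx r
    | mem x hx =>
      obtain ⟨y, rfl⟩ := hx
      have h := sub_mem_of_sameCycle (e := e) (S := S) (v := b)
        (fun y ↦ AddSubgroup.subset_closure ⟨b y, by simp [hσ]⟩)
        (Quotient.exact (Quotient.out_eq (q y)))
      simpa [Φ, Ψ] using h
  simpa [hΦt] using hΨΦ t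

end Permutation

/-- let `p` be a prime, `X` a type, `A = (X →₀ ℤ)` the free abelian group on
`X`, and `j ≥ 0`.  If `t ∈ A^{⊗p^j}` satisfies `N_{p^j}(t) = 0` then `t` lies in the
additive subgroup of `A^{⊗p^j}` generated by the elements `σ_j(s) − s`; equivalently, the
transfer from the `C_{p^j}`-coinvariants to the `C_{p^j}`-invariants induced by `N_{p^j}`
is injective. -/
theorem statement13 (p : ℕ) [NeZero p] (hp : p.Prime) (X : Type*) (j : ℕ)
    (t : Tp (X →₀ ℤ) (p ^ j)) (ht : normT (X →₀ ℤ) (p ^ j) t = 0) :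
    t ∈ AddSubgroup.closure
        (Set.range (fun s : Tp (X →₀ ℤ) (p ^ j) => sigmaT (X →₀ ℤ) (p ^ j) s - s)) := by
  let e := Equiv.addRight (1 : Fin (p ^ j))
  let b := Basis.piTensorProduct fun _ : Fin (p ^ j) ↦
    (Finsupp.basisSingleOne : Module.Basis X ℤ (X →₀ ℤ))
  refine mem_closure_of_sum_iterate_eq_zero b (e.arrowCongr (Equiv.refl X))
    (sigmaT (X →₀ ℤ) (p ^ j)).toLinearMap (fun f ↦ ?_) (NeZero.ne (p ^ j)) ht
  simp only [b, Basis.piTensorProduct_apply, LinearEquiv.coe_coe, sigmaT]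
  exact PiTensorProduct.reindex_tprod _ _
end

section
/- Let p be a prime and R a commutative ring with no p-power torsion (i.e. for all r ∈ R, p·r = 0 implies r = 0). Suppose that the quotient ring R/pR is a perfect ring of characteristic p (the Frobenius x ↦ x^p on R/pR is bijective). Then for every n ≥ 1 there is a ring isomorphism between the ring of n-truncated p-typical Witt vectors W_n(R/pR) (Mathlib's TruncatedWittVector p n (R/pR)) and the quotient ring R/p^nR. -/
namespace WittVector

variable {p : ℕ} [Fact p.Prime] {R : Type*} [CommRing R]

/-- If `p` is a non-zero-divisor in `R` and `R / p` is reduced, then `p ^ (m + 1)` divides the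
`m`-th ghost component of a Witt vector only if `p` divides its first `m + 1` coefficients. -/
theorem dvd_coeff_of_pow_dvd_ghostComponent
    (htor : ∀ r : R, (p : R) * r = 0 → r = 0)
    (hred : ∀ (r : R) (k : ℕ), (p : R) ∣ r ^ k → (p : R) ∣ r)
    {m : ℕ} {y : WittVector p R} (h : (p : R) ^ (m + 1) ∣ ghostComponent m y) :
    ∀ i ≤ m, (p : R) ∣ y.coeff i := by
  intro i
  induction i using Nat.strong_induction_on with
  | _ i ih =>
    intro hi
    rw [ghostComponent_apply, aeval_wittPolynomial] at h
    have hlow : ∀ j ∈ Finset.range (m + 1), j ≠ i →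
        (p : R) ^ (i + 1) ∣ (p : R) ^ j * y.coeff j ^ p ^ (m - j) := by
      intro j _ hji
      rcases lt_or_gt_of_ne hji with hlt | hgt
      · have hle : i + 1 ≤ j + p ^ (m - j) := by
          have := (Nat.lt_pow_self (Fact.out : p.Prime).one_lt : m - j < p ^ (m - j))
          omega
        refine (pow_dvd_pow _ hle).trans ?_
        rw [pow_add]
        exact mul_dvd_mul_left _ (pow_dvd_pow_of_dvd (ih j hlt (by omega)) _)
      · exact (pow_dvd_pow _ hgt).mul_right _
    have hi_mem : i ∈ Finset.range (m + 1) := Finset.mem_range.2 (by omega)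
    rw [← Finset.add_sum_erase _ _ hi_mem] at h
    have hrest := Finset.dvd_sum (s := (Finset.range (m + 1)).erase i)
      fun j hj ↦ hlow j (Finset.mem_of_mem_erase hj) (Finset.ne_of_mem_erase hj)
    have hterm := (dvd_add_left hrest).1 ((pow_dvd_pow (p : R) (by omega : i + 1 ≤ m + 1)).trans h)
    have hreg : IsLeftRegular ((p : R) ^ i) :=
      (isLeftRegular_iff_right_eq_zero_of_mul.2 htor).pow i
    rw [pow_succ] at hterm
    obtain ⟨c, hc⟩ := hterm
    exact hred _ _ ⟨c, hreg (by simpa [mul_assoc] using hc)⟩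

/-- If the `p ^ m`-th power map is surjective modulo `p`, then so is the `m`-th ghost component
modulo any power of `p`. -/
theorem exists_pow_dvd_sub_ghostComponent {m : ℕ}
    (hpow : ∀ r : R, ∃ x : R, (p : R) ∣ r - x ^ p ^ m) (j : ℕ) (r : R) :
    ∃ w : WittVector p R, (p : R) ^ j ∣ r - ghostComponent m w := by
  induction j generalizing r with
  | zero => exact ⟨0, by simp⟩
  | succ j ih =>
    obtain ⟨x, s, hs⟩ := hpow r
    obtain ⟨w, c, hc⟩ := ih s
    refine ⟨teichmuller p x + (p : WittVector p R) * w, c, ?_⟩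
    rw [map_add, map_mul, map_natCast, ghostComponent_teichmuller]
    linear_combination hs + (p : R) * hc

end WittVector

/-- let `p` be a prime and `R` a commutative ring with no `p`-power torsion
(`p·r = 0 → r = 0`).  If the quotient `R/pR` is a perfect ring of characteristic `p` (the
Frobenius `x ↦ x^p` is bijective), then for every `n ≥ 1` there is a ring isomorphism
between the ring of `n`-truncated `p`-typical Witt vectors `W_n(R/pR)` and the quotient
ring `R/p^nR`. -/
theorem statement15 (p : ℕ) [Fact p.Prime] (R : Type*) [CommRing R]
    (htor : ∀ r : R, (p : R) * r = 0 → r = 0)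
    [CharP (R ⧸ Ideal.span {(p : R)}) p]
    (hperf : Function.Bijective (fun x : R ⧸ Ideal.span {(p : R)} => x ^ p))
    (n : ℕ) (hn : 1 ≤ n) :
    Nonempty
      (TruncatedWittVector p n (R ⧸ Ideal.span {(p : R)}) ≃+*
        R ⧸ Ideal.span {(p : R) ^ n}) := by
  obtain ⟨m, rfl⟩ : ∃ m, n = m + 1 := ⟨n - 1, by omega⟩
  have hiter : ∀ k, Function.Bijective (fun x : R ⧸ Ideal.span {(p : R)} ↦ x ^ p ^ k) := by
    intro k
    induction k with
    | zero => simpa [Function.id_def] using Function.bijective_id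
    | succ k ih => simpa [Function.comp_def, pow_succ, pow_mul] using hperf.comp ih
  have hred : ∀ (r : R) (k : ℕ), (p : R) ∣ r ^ k → (p : R) ∣ r := by
    intro r k hr
    rw [← Ideal.Quotient.eq_zero_iff_dvd] at hr ⊢
    have hle : k ≤ p ^ k := (Nat.lt_pow_self (Fact.out : p.Prime).one_lt).le
    apply (hiter k).1
    have hp0 : p ^ k ≠ 0 := pow_ne_zero _ (Fact.out : p.Prime).ne_zero
    exact (pow_eq_zero_of_le hle ((map_pow _ r k).symm.trans hr)).trans (zero_pow hp0).symm
  have hpow : ∀ r : R, ∃ x : R, (p : R) ∣ r - x ^ p ^ m := by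
    intro r
    obtain ⟨x, hx⟩ := (hiter m).2 (Ideal.Quotient.mk _ r)
    obtain ⟨x, rfl⟩ := Ideal.Quotient.mk_surjective x
    refine ⟨x, ?_⟩
    rw [← Ideal.Quotient.eq_zero_iff_dvd, map_sub, map_pow, ← hx, sub_self]
  let θ := WittVector.ghostComponentModPPow (p := p) (R := R) m
  have hmk := WittVector.map_surjective (p := p) _
    (Ideal.Quotient.mk_surjective (I := Ideal.span {(p : R)}))
  have hθ : Function.Surjective θ := by
    intro r
    obtain ⟨r, rfl⟩ := Ideal.Quotient.mk_surjective r
    obtain ⟨w, hw⟩ := WittVector.exists_pow_dvd_sub_ghostComponent hpow (m + 1) r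
    refine ⟨WittVector.map (Ideal.Quotient.mk _) w, ?_⟩
    rw [WittVector.ghostComponentModPPow_map_mk, eq_comm, Ideal.Quotient.eq,
      Ideal.span_singleton_pow, Ideal.mem_span_singleton]
    exact hw
  have hker : RingHom.ker (WittVector.truncate (p := p) (m + 1)) = RingHom.ker θ := by
    ext x
    obtain ⟨y, rfl⟩ := hmk x
    rw [WittVector.mem_ker_truncate, RingHom.mem_ker, WittVector.ghostComponentModPPow_map_mk,
      Ideal.Quotient.eq_zero_iff_mem, Ideal.span_singleton_pow, Ideal.mem_span_singleton]
    simp only [WittVector.map_coeff, Ideal.Quotient.eq_zero_iff_dvd, Nat.lt_succ_iff]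
    exact ⟨WittVector.pow_dvd_ghostComponent_of_dvd_coeff,
      WittVector.dvd_coeff_of_pow_dvd_ghostComponent htor hred⟩
  exact ⟨(RingHom.quotientKerEquivOfSurjective (WittVector.truncate_surjective p (m + 1) _)).symm
    |>.trans (Ideal.quotEquivOfEq hker)
    |>.trans (RingHom.quotientKerEquivOfSurjective hθ)
    |>.trans (Ideal.quotEquivOfEq (Ideal.span_singleton_pow _ _))⟩
end

section
/- Let p be a prime and A a commutative ring. In the commutative ring A^{⊗p} (the p-fold tensor power of A over ℤ, with factorwise multiplication), for all a₀, b₀ ∈ A and all a₁, b₁ ∈ A^{⊗p}, the following identity holds: (a₀·b₀)^{⊗p} + N(a₀^{⊗p}·b₁ + a₁·b₀^{⊗p} + Σ_{s=0}^{p−1} a₁·σ_1^s(b₁)) = (a₀^{⊗p} + N(a₁)) · (b₀^{⊗p} + N(b₁)), where N = Σ_{s=0}^{p−1} σ_1^s. (This identity expresses that the first ghost component of the product formula for 2-truncated p-typical Witt vectors with coefficients is multiplicative.) -/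
open scoped TensorProduct

noncomputable section

/-- The `m`-fold tensor power over `ℤ` of a commutative ring `A`, indexed by `Fin m`; it is
a commutative ring in which elementary tensors multiply factorwise. -/
abbrev TpR (A : Type*) [CommRing A] (m : ℕ) : Type _ := ⨂[ℤ] _ : Fin m, A

/-- The cyclic permutation `σ_1` on the tensor power, induced by reindexing along
`x ↦ x + 1` on `Fin m`, so that `σ_1(a_1 ⊗ ⋯ ⊗ a_m) = a_m ⊗ a_1 ⊗ ⋯ ⊗ a_{m-1}`. -/
def sigmaR (A : Type*) [CommRing A] (m : ℕ) [NeZero m] : TpR A m ≃ₗ[ℤ] TpR A m :=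
  PiTensorProduct.reindex ℤ (fun _ : Fin m => A) (Equiv.addRight (1 : Fin m))

/-- The norm map `N = Σ_{s=0}^{m-1} σ_1^s` on the tensor power. -/
def normR (A : Type*) [CommRing A] (m : ℕ) [NeZero m] : TpR A m → TpR A m :=
  fun x => ∑ s ∈ Finset.range m, (⇑(sigmaR A m))^[s] x

end

section SigmaNorm

variable {A : Type*} [CommRing A] {m : ℕ} [NeZero m]

theorem sigmaR_tprod (f : Fin m → A) :
    sigmaR A m (PiTensorProduct.tprod ℤ f) = PiTensorProduct.tprod ℤ fun i => f (i - 1) := by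
  simp [sigmaR, PiTensorProduct.reindex_tprod, sub_eq_add_neg]

theorem sigmaR_mul (x y : TpR A m) : sigmaR A m (x * y) = sigmaR A m x * sigmaR A m y := by
  induction x using PiTensorProduct.induction_on with
  | add x₁ x₂ h₁ h₂ => simp only [add_mul, map_add, h₁, h₂]
  | smul_tprod r f =>
    induction y using PiTensorProduct.induction_on with
    | add y₁ y₂ h₁ h₂ => simp only [mul_add, map_add, h₁, h₂]
    | smul_tprod t g =>
      simp only [smul_mul_assoc, mul_smul_comm, map_smul, PiTensorProduct.tprod_mul_tprod,
        sigmaR_tprod]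
      rfl

theorem sigmaR_iterate_mul (k : ℕ) (x y : TpR A m) :
    (⇑(sigmaR A m))^[k] (x * y) = (⇑(sigmaR A m))^[k] x * (⇑(sigmaR A m))^[k] y :=
  Function.Semiconj₂.iterate sigmaR_mul k x y

theorem sigmaR_iterate_tprod (k : ℕ) (f : Fin m → A) :
    (⇑(sigmaR A m))^[k] (PiTensorProduct.tprod ℤ f)
      = PiTensorProduct.tprod ℤ fun i => f (i - Fin.ofNat m k) := by
  induction k generalizing f with
  | zero => simp
  | succ k ih =>
    rw [Function.iterate_succ_apply, sigmaR_tprod, ih]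
    congr 1
    funext i
    congr 1
    have h : Fin.ofNat m (k + 1) = Fin.ofNat m k + 1 := by
      ext
      simp [Fin.val_add]
    rw [h, sub_sub]

theorem sigmaR_iterate_add (k : ℕ) (x y : TpR A m) :
    (⇑(sigmaR A m))^[k] (x + y) = (⇑(sigmaR A m))^[k] x + (⇑(sigmaR A m))^[k] y :=
  iterate_map_add (sigmaR A m) k x y

theorem sigmaR_iterate_self (x : TpR A m) : (⇑(sigmaR A m))^[m] x = x := by
  induction x using PiTensorProduct.induction_on with
  | add x y hx hy => rw [sigmaR_iterate_add, hx, hy]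
  | smul_tprod r f =>
    have h : Fin.ofNat m m = 0 := by
      ext
      simp
    rw [iterate_map_zsmul, sigmaR_iterate_tprod]
    congr 2
    funext i
    rw [h, sub_zero]

theorem sigmaR_normR (x : TpR A m) : sigmaR A m (normR A m x) = normR A m x := by
  have h := Finset.sum_range_succ' (fun s => (⇑(sigmaR A m))^[s] x) m
  rw [Finset.sum_range_succ, sigmaR_iterate_self, Function.iterate_zero_apply,
    add_left_inj] at h
  simp only [normR, map_sum, ← Function.iterate_succ_apply']
  exact h.symm

theorem sigmaR_tprod_const (a : A) :
    sigmaR A m (PiTensorProduct.tprod ℤ fun _ => a) = PiTensorProduct.tprod ℤ fun _ => a :=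
  sigmaR_tprod _

theorem normR_add (x y : TpR A m) : normR A m (x + y) = normR A m x + normR A m y := by
  simp only [normR, sigmaR_iterate_add, Finset.sum_add_distrib]

/-- The projection formula for the norm map, for a `σ_1`-invariant right factor. -/
theorem normR_mul_of_fixed (x : TpR A m) {y : TpR A m} (hy : sigmaR A m y = y) :
    normR A m (x * y) = normR A m x * y := by
  simp only [normR, sigmaR_iterate_mul, Function.iterate_fixed hy, Finset.sum_mul]

end SigmaNorm

/-- let `p` be a prime and `A` a commutative ring.  In the commutative ring
`A^{⊗p}` with factorwise multiplication, for all `a₀ b₀ ∈ A` and `a₁ b₁ ∈ A^{⊗p}`: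
`(a₀·b₀)^{⊗p} + N(a₀^{⊗p}·b₁ + a₁·b₀^{⊗p} + Σ_{s=0}^{p-1} a₁·σ_1^s(b₁))
  = (a₀^{⊗p} + N(a₁)) · (b₀^{⊗p} + N(b₁))`. -/
theorem statement16 (p : ℕ) [NeZero p] (hp : p.Prime) (A : Type*) [CommRing A]
    (a₀ b₀ : A) (a₁ b₁ : TpR A p) :
    PiTensorProduct.tprod ℤ (fun _ : Fin p => a₀ * b₀)
        + normR A p (PiTensorProduct.tprod ℤ (fun _ : Fin p => a₀) * b₁
            + a₁ * PiTensorProduct.tprod ℤ (fun _ : Fin p => b₀)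
            + ∑ s ∈ Finset.range p, a₁ * (⇑(sigmaR A p))^[s] b₁)
      = (PiTensorProduct.tprod ℤ (fun _ : Fin p => a₀) + normR A p a₁)
          * (PiTensorProduct.tprod ℤ (fun _ : Fin p => b₀) + normR A p b₁) := by
  rw [← Finset.mul_sum]
  change _ + normR A p (_ + _ + a₁ * normR A p b₁) = _
  rw [normR_add, normR_add, mul_comm _ b₁, normR_mul_of_fixed _ (sigmaR_tprod_const a₀),
    normR_mul_of_fixed _ (sigmaR_tprod_const b₀), normR_mul_of_fixed _ (sigmaR_normR b₁)]
  have h : PiTensorProduct.tprod ℤ (fun _ : Fin p => a₀ * b₀)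
      = PiTensorProduct.tprod ℤ (fun _ : Fin p => a₀)
        * PiTensorProduct.tprod ℤ (fun _ : Fin p => b₀) :=
    (PiTensorProduct.tprod_mul_tprod _ _).symm
  rw [h]
  ring
end
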